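/- Let λ ∈ (0,1], let m = (m_k)_{k≥1} and m̃ = (m̃_k)_{k≥1} be nonincreasing sequences of nonnegative reals with ∑_{k≥1} m_k^λ < ∞ and ∑_{k≥1} m̃_k^λ < ∞, let i ≥ 1, and let θ = (θ_k)_{k≥1} be a sequence of reals with 1 > θ₁ ≥ θ₂ ≥ ⋯ ≥ 0, ∑_{k≥1} θ_k ≤ 1 and ∑_{k≥1} θ_k^λ < ∞. Let f and f̃ be the nonincreasing rearrangements of the families {m_k : k ≠ i} ∪ {θ_k m_i : k ≥ 1} and {m̃_k : k ≠ i} ∪ {θ_k m̃_i : k ≥ 1} respectively. Then ∑_{k≥1} |f_k^λ − f̃_k^λ| ≤ ∑_{k≥1} |m_k^λ − m̃_k^λ| + |m_i^λ − m̃_i^λ| · (∑_{k≥1} θ_k^λ − 1). -/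

import Mathlib

open scoped ENNReal

open MeasureTheory

theorem encard_mem_Ico_eq_tsum_indicator (a b : ℕ → ℝ) (t : ℝ) :
    ({k | t ∈ Set.Ico (min (a k) (b k)) (max (a k) (b k))}.encard : ℝ≥0∞) =
      ∑' k, (Set.Ico (min (a k) (b k)) (max (a k) (b k))).indicator 1 t := by
  rw [← ENNReal.tsum_set_one, tsum_subtype _ fun _ => (1 : ℝ≥0∞)]
  rfl

theorem measurable_encard_mem_Ico (a b : ℕ → ℝ) :
    Measurable fun t : ℝ =>
      ({k | t ∈ Set.Ico (min (a k) (b k)) (max (a k) (b k))}.encard : ℝ≥0∞) := by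
  simp_rw [encard_mem_Ico_eq_tsum_indicator]
  exact Measurable.tsum fun k => measurable_one.indicator measurableSet_Ico

/-- Layer-cake formula for the `ℓ¹` distance of two real sequences. -/
theorem tsum_ofReal_abs_sub_eq_lintegral_encard (a b : ℕ → ℝ) :
    ∑' k, ENNReal.ofReal |a k - b k| =
      ∫⁻ t : ℝ, ({k | t ∈ Set.Ico (min (a k) (b k)) (max (a k) (b k))}.encard : ℝ≥0∞) := by
  simp_rw [encard_mem_Ico_eq_tsum_indicator]
  rw [lintegral_tsum fun k => (measurable_one.indicator measurableSet_Ico).aemeasurable]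
  congr! 2 with k
  rw [lintegral_indicator_one measurableSet_Ico, Real.volume_Ico, max_sub_min_eq_abs']

theorem Set.encard_le_encard_add_encard_diff {α : Type*} (s t : Set α) :
    s.encard ≤ t.encard + (s \ t).encard := by
  rw [← Set.encard_sdiff_add_encard_inter s t, add_comm]
  gcongr
  exact Set.inter_subset_right

theorem encard_diff_le_of_isLowerSet {α β : Type*} {s t : Set ℕ} {a a' : Set α} {b b' : Set β}
    (ht : IsLowerSet t) (hts : t ⊆ s) (hs_card : s.encard = a.encard + b.encard)
    (ht_card : t.encard = a'.encard + b'.encard) :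
    (s \ t).encard ≤ (a \ a').encard + (b \ b').encard := by
  by_cases hfin : t.Finite
  · rw [← ENat.add_le_add_iff_right (Set.encard_ne_top_iff.2 hfin),
      Set.encard_sdiff_add_encard_of_subset hts, hs_card, ht_card]
    calc a.encard + b.encard
        ≤ (a'.encard + (a \ a').encard) + (b'.encard + (b \ b').encard) :=
          add_le_add (Set.encard_le_encard_add_encard_diff _ _)
            (Set.encard_le_encard_add_encard_diff _ _)
      _ = _ := by ring
  · have huniv : t = Set.univ := by
      refine Set.eq_univ_of_forall fun n => ?_
      obtain ⟨k, hk, hnk⟩ := Set.Infinite.exists_gt hfin n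
      exact ht hnk.le hk
    simp [huniv]

/-- Merging two families and rearranging the result contracts the `ℓ¹` distance. -/
theorem tsum_abs_sub_rearrangement_le {f g u u' v v' : ℕ → ℝ}
    (hf : Antitone f) (hg : Antitone g) (hfnn : ∀ k, 0 ≤ f k) (hgnn : ∀ k, 0 ≤ g k)
    (hf_card : ∀ t : ℝ, 0 < t → {k | t < f k}.encard = {k | t < u k}.encard + {k | t < v k}.encard)
    (hg_card : ∀ t : ℝ, 0 < t →
      {k | t < g k}.encard = {k | t < u' k}.encard + {k | t < v' k}.encard) :
    ∑' k, ENNReal.ofReal |f k - g k| ≤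
      ∑' k, ENNReal.ofReal |u k - u' k| + ∑' k, ENNReal.ofReal |v k - v' k| := by
  have hIco (a b : ℕ → ℝ) (t : ℝ) : {k | t ∈ Set.Ico (min (a k) (b k)) (max (a k) (b k))} =
      ({k | t < a k} \ {k | t < b k}) ∪ ({k | t < b k} \ {k | t < a k}) := by
    ext k
    simp only [Set.mem_ofPred_eq, Set.mem_Ico, min_le_iff, lt_max_iff, Set.mem_union, Set.mem_sdiff,
      not_lt]
    grind
  have hlower {a : ℕ → ℝ} (ha : Antitone a) (t : ℝ) : IsLowerSet {k | t < a k} :=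
    fun _ _ hkl hk => lt_of_lt_of_le hk (ha hkl)
  simp_rw [tsum_ofReal_abs_sub_eq_lintegral_encard]
  rw [← lintegral_add_left (measurable_encard_mem_Ico u u')]
  refine lintegral_mono_ae ?_
  filter_upwards [Measure.ae_ne volume (0 : ℝ)] with t ht0
  rcases lt_or_gt_of_ne ht0 with ht | ht
  · have : {k | t ∈ Set.Ico (min (f k) (g k)) (max (f k) (g k))} = ∅ :=
      Set.eq_empty_of_forall_notMem fun k hk =>
        absurd (hk.1.trans_lt ht) (not_lt.2 (le_min (hfnn k) (hgnn k)))
    simp only [this, Set.encard_empty, ENat.toENNReal_zero, zero_le]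
  · suffices h : ∀ {a b : ℕ → ℝ} {u u' v v' : ℕ → ℝ}, {k | t < b k} ⊆ {k | t < a k} →
        IsLowerSet {k | t < b k} →
        {k | t < a k}.encard = {k | t < u k}.encard + {k | t < v k}.encard →
        {k | t < b k}.encard = {k | t < u' k}.encard + {k | t < v' k}.encard →
        {k | t ∈ Set.Ico (min (a k) (b k)) (max (a k) (b k))}.encard ≤
          {k | t ∈ Set.Ico (min (u k) (u' k)) (max (u k) (u' k))}.encard +
          {k | t ∈ Set.Ico (min (v k) (v' k)) (max (v k) (v' k))}.encard by
      norm_cast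
      rcases (hlower hg t).total (hlower hf t) with hsub | hsub
      · exact h hsub (hlower hg t) (hf_card t ht) (hg_card t ht)
      · simpa only [min_comm, max_comm] using h hsub (hlower hf t) (hg_card t ht) (hf_card t ht)
    intro a b u u' v v' hsub hb ha_card hb_card
    simp_rw [hIco]
    rw [Set.sdiff_eq_empty.2 hsub, Set.union_empty]
    refine (encard_diff_le_of_isLowerSet hb hsub ha_card hb_card).trans ?_
    gcongr <;> exact Set.subset_union_left

theorem rearrangement_rpow_encard {lam : ℝ} (hlam : 0 < lam) {m θ f : ℕ → ℝ} {i : ℕ}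
    (hmnn : ∀ k, 0 ≤ m k) (hθnn : ∀ k, 0 ≤ θ k) (hfnn : ∀ k, 0 ≤ f k)
    (hf : ∀ t : ℝ, 0 < t →
      {k | t < f k}.encard = {k | k ≠ i ∧ t < m k}.encard + {k | t < θ k * m i}.encard)
    (t : ℝ) (ht : 0 < t) :
    {k | t < f k ^ lam}.encard =
      {k | t < if k = i then 0 else m k ^ lam}.encard + {k | t < θ k ^ lam * m i ^ lam}.encard := by
  have hlt {x : ℝ} (hx : 0 ≤ x) : t < x ^ lam ↔ t ^ lam⁻¹ < x :=
    (Real.rpow_inv_lt_iff_of_pos ht.le hx hlam).symm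
  have hrest (k : ℕ) : (t < if k = i then 0 else m k ^ lam) ↔ k ≠ i ∧ t ^ lam⁻¹ < m k := by
    split_ifs with h
    · simp [h, ht.le]
    · simp [h, hlt (hmnn k)]
  have hfrag (k : ℕ) : t < θ k ^ lam * m i ^ lam ↔ t ^ lam⁻¹ < θ k * m i := by
    rw [← Real.mul_rpow (hθnn k) (hmnn i), hlt (mul_nonneg (hθnn k) (hmnn i))]
  simp_rw [hrest, hfrag, hlt (hfnn _)]
  exact hf _ (Real.rpow_pos_of_pos ht _)

/-- Estimate (F3): d_λ(f_{iθ}(m), f_{iθ}(m̃)) ≤ d_λ(m, m̃) + |m_i^λ − m̃_i^λ|(∑_{k≥1} θ_k^λ − 1).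
Here `f` (resp. `ft`) is the nonincreasing rearrangement of the family consisting of
the entries of `m` (resp. `mt`) other than the i-th together with the fragments
θ_k·m_i (resp. θ_k·mt_i); rearrangements are encoded via extended cardinals of
super-level sets. The sums defining d_λ are taken in [0,∞]; since the correction term
|m_i^λ − m̃_i^λ|(∑θ_k^λ − 1) may be negative, its negative part is moved to the
left-hand side, which is equivalent to the stated inequality. -/
theorem stmt_16 (lam : ℝ) (hlam : lam ∈ Set.Ioc (0 : ℝ) 1)
    (m mt : ℕ → ℝ) (hm : Antitone m) (hmt : Antitone mt)
    (hmnn : ∀ k, 0 ≤ m k) (hmtnn : ∀ k, 0 ≤ mt k)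
    (hsum : Summable fun k => m k ^ lam) (hsumt : Summable fun k => mt k ^ lam)
    (i : ℕ)
    (θ : ℕ → ℝ) (hθ1 : θ 0 < 1) (hθanti : Antitone θ) (hθnn : ∀ k, 0 ≤ θ k)
    (hθsum : ∑' k, ENNReal.ofReal (θ k) ≤ 1)
    (hθlam : Summable fun k => θ k ^ lam)
    (f : ℕ → ℝ) (hf_anti : Antitone f) (hfnn : ∀ k, 0 ≤ f k)
    (hf : ∀ t : ℝ, 0 < t →
      {k | t < f k}.encard =
        {k | k ≠ i ∧ t < m k}.encard + {k | t < θ k * m i}.encard)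
    (ft : ℕ → ℝ) (hft_anti : Antitone ft) (hftnn : ∀ k, 0 ≤ ft k)
    (hft : ∀ t : ℝ, 0 < t →
      {k | t < ft k}.encard =
        {k | k ≠ i ∧ t < mt k}.encard + {k | t < θ k * mt i}.encard) :
    (∑' k, ENNReal.ofReal |f k ^ lam - ft k ^ lam|) +
        ENNReal.ofReal (|m i ^ lam - mt i ^ lam| * (1 - ∑' k, θ k ^ lam)) ≤
      (∑' k, ENNReal.ofReal |m k ^ lam - mt k ^ lam|) +
        ENNReal.ofReal (|m i ^ lam - mt i ^ lam| * ((∑' k, θ k ^ lam) - 1)) := by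
  have hlam0 := hlam.1
  set D := |m i ^ lam - mt i ^ lam| with hD
  have hD0 : 0 ≤ D := abs_nonneg _
  set S := ∑' k, θ k ^ lam with hS
  have hS0 : 0 ≤ S := tsum_nonneg fun k => Real.rpow_nonneg (hθnn k) _
  have hmerge : ∑' k, ENNReal.ofReal |f k ^ lam - ft k ^ lam| ≤
      ∑' k, ENNReal.ofReal
        |(if k = i then 0 else m k ^ lam) - (if k = i then 0 else mt k ^ lam)| +
      ∑' k, ENNReal.ofReal |θ k ^ lam * m i ^ lam - θ k ^ lam * mt i ^ lam| := tsum_abs_sub_rearrangement_le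
    (fun k l h => Real.rpow_le_rpow (hfnn l) (hf_anti h) hlam0.le)
    (fun k l h => Real.rpow_le_rpow (hftnn l) (hft_anti h) hlam0.le)
    (fun k => Real.rpow_nonneg (hfnn k) lam) (fun k => Real.rpow_nonneg (hftnn k) lam)
    (rearrangement_rpow_encard hlam0 hmnn hθnn hfnn hf)
    (rearrangement_rpow_encard hlam0 hmtnn hθnn hftnn hft)
  have hfrag : ∑' k, ENNReal.ofReal |θ k ^ lam * m i ^ lam - θ k ^ lam * mt i ^ lam| =
      ENNReal.ofReal (D * S) := by
    rw [hS, ← tsum_mul_left, ENNReal.ofReal_tsum_of_nonneg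
      (fun k => mul_nonneg hD0 (Real.rpow_nonneg (hθnn k) _)) (hθlam.mul_left D)]
    congr! 2 with k
    rw [← mul_sub, abs_mul, abs_of_nonneg (Real.rpow_nonneg (hθnn k) _), mul_comm]
  have hsplit : ∑' k, ENNReal.ofReal |m k ^ lam - mt k ^ lam| = ENNReal.ofReal D +
      ∑' k, ENNReal.ofReal
        |(if k = i then 0 else m k ^ lam) - (if k = i then 0 else mt k ^ lam)| := by
    rw [ENNReal.tsum_eq_add_tsum_ite i]
    congr! 3 with k
    split_ifs <;> simp
  have hcorr : ENNReal.ofReal (D * S) + ENNReal.ofReal (D * (1 - S)) =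
      ENNReal.ofReal D + ENNReal.ofReal (D * (S - 1)) := by
    rcases le_total S 1 with h | h
    · rw [ENNReal.ofReal_of_nonpos (mul_nonpos_of_nonneg_of_nonpos hD0 (sub_nonpos.2 h)),
        ← ENNReal.ofReal_add (mul_nonneg hD0 hS0) (mul_nonneg hD0 (sub_nonneg.2 h)), add_zero]
      ring_nf
    · rw [ENNReal.ofReal_of_nonpos (mul_nonpos_of_nonneg_of_nonpos hD0 (sub_nonpos.2 h)),
        ← ENNReal.ofReal_add hD0 (mul_nonneg hD0 (sub_nonneg.2 h)), add_zero]
      ring_nf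
  rw [hfrag] at hmerge
  refine (add_le_add hmerge le_rfl).trans_eq ?_
  rw [add_assoc, hcorr, hsplit, ← add_assoc, add_comm (ENNReal.ofReal D)]
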